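/- Let i be the mosaic injection sending an n-mosaic M to the (n+1)-mosaic i(M) obtained by appending one additional row and one additional column consisting only of empty tiles T0. Then M is suitably connected if and only if i(M) is suitably connected. -/

import Mathlib

/-- The 15 mosaic tiles. -/
inductive Tile where
  | T0 | T1 | T2 | T3 | T4 | T5 | T6 | T7 | T8 | T9 | T10 | T11 | T12 | T13 | T14
  deriving DecidableEq

instance : Fintype Tile where
  elems := {.T0, .T1, .T2, .T3, .T4, .T5, .T6, .T7, .T8, .T9, .T10, .T11, .T12, .T13, .T14}
  complete := by intro x; cases x <;> decide

namespace Tile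

/-- Whether a tile has a connection point on its top edge. -/
def top : Tile → Bool
  | T3 | T4 | T6 | T7 | T8 | T9 | T10 | T11 | T12 | T13 | T14 => true
  | _ => false

/-- Whether a tile has a connection point on its bottom edge. -/
def bottom : Tile → Bool
  | T1 | T2 | T6 | T7 | T8 | T9 | T10 | T11 | T12 | T13 | T14 => true
  | _ => false

/-- Whether a tile has a connection point on its left edge. -/
def left : Tile → Bool
  | T1 | T4 | T5 | T7 | T8 | T9 | T10 | T11 | T12 | T13 | T14 => true
  | _ => false

/-- Whether a tile has a connection point on its right edge. -/
def right : Tile → Bool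
  | T2 | T3 | T5 | T7 | T8 | T9 | T10 | T11 | T12 | T13 | T14 => true
  | _ => false

end Tile

/-- An (m,n)-mosaic (rows indexed by `Fin m`, columns by `Fin n`) is suitably connected if
every connection point of every tile coincides with a connection point of a contiguous tile. -/
def SuitablyConnected {m n : ℕ} (M : Fin m → Fin n → Tile) : Prop :=
  ∀ (i : Fin m) (j : Fin n),
    ((M i j).top = true → ∃ i' : Fin m, i'.val + 1 = i.val ∧ (M i' j).bottom = true) ∧
    ((M i j).bottom = true → ∃ i' : Fin m, i.val + 1 = i'.val ∧ (M i' j).top = true) ∧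
    ((M i j).left = true → ∃ j' : Fin n, j'.val + 1 = j.val ∧ (M i j').right = true) ∧
    ((M i j).right = true → ∃ j' : Fin n, j.val + 1 = j'.val ∧ (M i j').left = true)

/-- The mosaic injection: append one additional row and one additional column of empty tiles. -/
def mosaicInjection {n : ℕ} (M : Fin n → Fin n → Tile) : Fin (n + 1) → Fin (n + 1) → Tile :=
  fun i j =>
    if h : i.val < n ∧ j.val < n then M ⟨i.val, h.1⟩ ⟨j.val, h.2⟩ else Tile.T0

theorem mosaicInjection_castSucc {n : ℕ} (M : Fin n → Fin n → Tile) (i j : Fin n) :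
    mosaicInjection M i.castSucc j.castSucc = M i j := by
  simp [mosaicInjection]

theorem mosaicInjection_last_left {n : ℕ} (M : Fin n → Fin n → Tile) (j : Fin (n + 1)) :
    mosaicInjection M (Fin.last n) j = Tile.T0 := by
  simp [mosaicInjection]

theorem mosaicInjection_last_right {n : ℕ} (M : Fin n → Fin n → Tile) (i : Fin (n + 1)) :
    mosaicInjection M i (Fin.last n) = Tile.T0 := by
  simp [mosaicInjection]

/-- An n-mosaic M is suitably connected if and only if the (n+1)-mosaic i(M),
obtained by appending one row and one column of empty tiles, is suitably connected. -/
theorem suitablyConnected_mosaicInjection {n : ℕ} (M : Fin n → Fin n → Tile) :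
    SuitablyConnected M ↔ SuitablyConnected (mosaicInjection M) := by
  simp [SuitablyConnected, Fin.forall_fin_succ', Fin.exists_fin_succ', mosaicInjection_castSucc,
    mosaicInjection_last_left, mosaicInjection_last_right, Tile.top, Tile.bottom, Tile.left,
    Tile.right]
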